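/- arXiv:2301.08230 — 5 statements merged into one kernel-verified Lean document; each statement's English description precedes it below -/
import Mathlib

section
/- Let T, U ∈ ℝ^{d×n} with d ≥ n, rank(T) = rank(U) = n, and suppose U·U⁺·T = T, where U⁺ = (UᵀU)⁻¹Uᵀ. Then the n×n matrix T⁺·U is invertible, where T⁺ = (TᵀT)⁻¹Tᵀ; consequently H(U) := (T⁺U)ᵀ is invertible. -/
open Matrix

/-- If `T, U ∈ ℝ^{d×n}` with `d ≥ n` both have rank `n` and `U·U⁺·T = T`
(where `U⁺ = (UᵀU)⁻¹Uᵀ`), then the `n×n` matrix `T⁺·U` (with `T⁺ = (TᵀT)⁻¹Tᵀ`)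
is invertible, and consequently `H(U) = (T⁺U)ᵀ` is invertible. -/
theorem stmt_3 {d n : ℕ} (hdn : n ≤ d) (T U : Matrix (Fin d) (Fin n) ℝ)
    (hT : T.rank = n) (hU : U.rank = n)
    (h : U * ((Uᵀ * U)⁻¹ * Uᵀ) * T = T) :
    IsUnit (((Tᵀ * T)⁻¹ * Tᵀ) * U).det ∧
      IsUnit ((((Tᵀ * T)⁻¹ * Tᵀ) * U)ᵀ).det := by
  have hr : (Tᵀ * T).rank = n := by rw [Matrix.rank_transpose_mul_self, hT]
  have hu : IsUnit (Tᵀ * T).det := by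
    rw [← Matrix.isUnit_iff_isUnit_det, ← Matrix.mulVec_surjective_iff_isUnit]
    have h1 : LinearMap.range (Tᵀ * T).mulVecLin = ⊤ := by
      apply Submodule.eq_top_of_finrank_eq
      have h2 : Module.finrank ℝ (LinearMap.range (Tᵀ * T).mulVecLin) = n := hr
      rw [h2]; simp
    exact LinearMap.range_eq_top.mp h1
  have key : (((Tᵀ * T)⁻¹ * Tᵀ) * U) * (((Uᵀ * U)⁻¹ * Uᵀ) * T) = 1 := by
    calc _ = ((Tᵀ * T)⁻¹ * Tᵀ) * (U * ((Uᵀ * U)⁻¹ * Uᵀ) * T) := by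
          simp only [Matrix.mul_assoc]
      _ = 1 := by rw [h, Matrix.mul_assoc, Matrix.nonsing_inv_mul _ hu]
  have hd := Matrix.isUnit_det_of_right_inverse key
  exact ⟨hd, by rwa [Matrix.det_transpose]⟩
end

section
/- Let p ≥ 1 and let u ∈ ℝ^p have all entries non-zero with pairwise distinct absolute values (u_i ≠ 0 for all i, and |u_i| ≠ |u_j| for i ≠ j). Let a ∈ ℝ. Then for every non-zero vector d ∈ ℝ^p there exists α ∈ ℝ such that Σ_{i=1}^{p} d_i · σ̇(α·u_i) ≠ a, where σ̇(x) = 1/(1 + e^{-x} + e^{x}) is the derivative of the sigmoid function. -/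
open Filter Topology in
lemma aux_abs (x v : ℝ) :
    1 + Real.exp (-(x * v)) + Real.exp (x * v)
      = 1 + Real.exp (-(x * |v|)) + Real.exp (x * |v|) := by
  rcases abs_choice v with h | h <;> rw [h]
  rw [mul_neg, neg_neg]; ring

open Filter Topology in
lemma aux_exp (c : ℝ) (hc : 0 < c) :
    Tendsto (fun x : ℝ => Real.exp (-(x * c))) atTop (𝓝 0) := by
  apply Real.tendsto_exp_neg_atTop_nhds_zero.comp
  exact tendsto_id.atTop_mul_const hc

open Filter Topology in
lemma aux_zero (v m : ℝ) (h : m < |v|) :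
    Tendsto (fun x : ℝ => 1 / (1 + Real.exp (-(x * v)) + Real.exp (x * v)) * Real.exp (x * m))
      atTop (𝓝 0) := by
  refine squeeze_zero (fun x => by positivity) (fun x => ?_) (aux_exp (|v| - m) (by linarith))
  rw [aux_abs, one_div_mul_eq_div, div_le_iff₀ (by positivity)]
  have : Real.exp (x * m) = Real.exp (-(x * (|v| - m))) * Real.exp (x * |v|) := by
    rw [← Real.exp_add]; ring_nf
  rw [this]
  gcongr
  have := Real.exp_pos (-(x * |v|))
  linarith

open Filter Topology in
lemma aux_one (v : ℝ) (h : 0 < |v|) :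
    Tendsto (fun x : ℝ => 1 / (1 + Real.exp (-(x * v)) + Real.exp (x * v)) * Real.exp (x * |v|))
      atTop (𝓝 1) := by
  have h1 := aux_exp |v| h
  have h2 : Tendsto (fun x : ℝ => (Real.exp (-(x * |v|))
      + Real.exp (-(x * |v|)) * Real.exp (-(x * |v|)) + 1)⁻¹) atTop (𝓝 1) := by
    have := ((h1.add (h1.mul h1)).add_const 1).inv₀ (by norm_num)
    simpa using this
  refine h2.congr fun x => ?_
  rw [aux_abs, Real.exp_neg]
  have := Real.exp_pos (x * |v|)
  field_simp

/-- No non-trivial linear combination of the functions `α ↦ σ̇(α·u_i)` is constant, where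
`σ̇(x) = 1/(1 + e^{-x} + e^x)` is the derivative of the sigmoid and the `u_i` are non-zero
with pairwise distinct absolute values. -/
theorem stmt_8 {p : ℕ} (hp : 1 ≤ p) (u : Fin p → ℝ)
    (hu0 : ∀ i, u i ≠ 0) (hu : ∀ i j, i ≠ j → |u i| ≠ |u j|)
    (a : ℝ) (d : Fin p → ℝ) (hd : d ≠ 0) :
    ∃ α : ℝ, ∑ i : Fin p, d i * (1 / (1 + Real.exp (-(α * u i)) + Real.exp (α * u i))) ≠ a := by
  by_contra! H
  have ha : a = 0 := by
    have h0 := tendsto_finsetSum (Finset.univ : Finset (Fin p)) (fun i _ =>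
      (aux_zero (u i) 0 (abs_pos.2 (hu0 i))).const_mul (d i))
    simp only [mul_zero, Real.exp_zero, mul_one, H, Finset.sum_const_zero] at h0
    exact tendsto_nhds_unique tendsto_const_nhds h0
  obtain ⟨j, hj⟩ := Function.ne_iff.1 hd
  obtain ⟨k, hk, hmin⟩ := Finset.exists_min_image
    (Finset.univ.filter fun i => d i ≠ 0) (fun i => |u i|) ⟨j, by simpa using hj⟩
  have hk' : d k ≠ 0 := by simpa using hk
  have h1 := tendsto_finsetSum (f := fun (i : Fin p) (x : ℝ) =>
      d i * (1 / (1 + Real.exp (-(x * u i)) + Real.exp (x * u i)) * Real.exp (x * |u k|)))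
      (x := Filter.atTop) (a := fun i => if i = k then d k else 0) Finset.univ (by
    intro i _
    by_cases hik : i = k
    · subst hik
      simpa using (aux_one (u i) (abs_pos.2 (hu0 i))).const_mul (d i)
    · by_cases hdi : d i = 0
      · simp [hdi, hik]
      · have hlt : |u k| < |u i| :=
          lt_of_le_of_ne (hmin i (by simpa using hdi)) (hu k i (Ne.symm hik))
        simpa [hik] using (aux_zero (u i) _ hlt).const_mul (d i))
  simp only [← mul_assoc, ← Finset.sum_mul, H, ha, zero_mul] at h1
  have h2 := tendsto_nhds_unique tendsto_const_nhds h1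
  simp at h2
  exact hk' h2.symm
end

section
/- Let d ≥ 1 and w ≥ 1, let W ∈ ℝ^{w×d} have rank d, all rows non-zero, and W_i ≠ W_j and W_i ≠ −W_j for all distinct rows i ≠ j; let ν ∈ ℝ^w have all entries non-zero. Define σ̇(x) = 1/(1 + e^{-x} + e^{x}). Then for every non-zero b ∈ ℝ^d and every a ∈ ℝ, there exists φ ∈ ℝ^d such that Σ_{i=1}^{w} ν_i · σ̇((Wφ)_i) · (Wb)_i ≠ a. In other words, for the two-layer neural network f(φ) = νᵀσ(Wφ) + ν₀ with sigmoid activation σ and full-rank first-layer weight matrix W, no non-zero vector b makes bᵀ∇f(φ) constant in φ. -/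
open Matrix

lemma aux_le (lam m t : ℝ) : 
    Real.exp (lam * t) * (1 / (1 + Real.exp (-(t * m)) + Real.exp (t * m)))
      ≤ Real.exp (-((|m| - lam) * t)) := by
  have h1 : Real.exp (t * |m|) ≤ 1 + Real.exp (-(t * m)) + Real.exp (t * m) := by
    have := Real.exp_pos (-(t * m))
    have := Real.exp_pos (t * m)
    rcases abs_cases m with ⟨h, _⟩ | ⟨h, _⟩ <;> rw [h]
    · linarith
    · rw [mul_neg]; linarith
  have h2 : 0 < Real.exp (t * |m|) := Real.exp_pos _
  calc _ ≤ Real.exp (lam * t) * (1 / Real.exp (t * |m|)) := by gcongr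
    _ = _ := by
      rw [one_div, ← Real.exp_neg, ← Real.exp_add]; congr 1; ring

open Filter Topology in
lemma aux_tend0 (lam m : ℝ) (h : lam < |m|) :
    Tendsto (fun t : ℝ => Real.exp (lam * t) * (1 / (1 + Real.exp (-(t * m)) + Real.exp (t * m))))
      atTop (𝓝 0) := by
  refine squeeze_zero (fun t => by positivity) (aux_le lam m) ?_
  exact Real.tendsto_exp_neg_atTop_nhds_zero.comp (tendsto_id.const_mul_atTop (sub_pos.2 h))

open Filter Topology in
lemma aux_tend1 (m : ℝ) (h : m ≠ 0) :
    Tendsto (fun t : ℝ => Real.exp (|m| * t) * (1 / (1 + Real.exp (-(t * m)) + Real.exp (t * m))))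
      atTop (𝓝 1) := by
  have h0 : 0 < |m| := abs_pos.2 h
  have e : Tendsto (fun t : ℝ => Real.exp (-(|m| * t))) atTop (𝓝 0) :=
    Real.tendsto_exp_neg_atTop_nhds_zero.comp (tendsto_id.const_mul_atTop h0)
  have e2 : Tendsto (fun t : ℝ => 1 / (1 + Real.exp (-(|m| * t)) + Real.exp (-(|m| * t)) ^ 2))
      atTop (𝓝 (1 / (1 + 0 + 0 ^ 2))) := by
    refine Tendsto.div tendsto_const_nhds ((tendsto_const_nhds.add e).add (e.pow 2)) (by norm_num)
  norm_num at e2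
  refine e2.congr fun t => ?_
  have key : 1 + Real.exp (-(t * m)) + Real.exp (t * m)
      = 1 + (Real.exp (|m| * t))⁻¹ + Real.exp (|m| * t) := by
    rcases abs_cases m with ⟨h, _⟩ | ⟨h, _⟩ <;> rw [h]
    · rw [Real.exp_neg, mul_comm m t]
    · rw [← Real.exp_neg, neg_mul, neg_neg, mul_comm m t]; ring
  rw [key, Real.exp_neg]
  have := Real.exp_pos (|m| * t)
  field_simp
  try ring

/-- generic direction -/
lemma aux_generic {d w : ℕ} (W : Matrix (Fin w) (Fin d) ℝ)
    (hrow0 : ∀ i, W i ≠ 0)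
    (hrows : ∀ i j, i ≠ j → W i ≠ W j)
    (hrows' : ∀ i j, i ≠ j → W i ≠ -W j) :
    ∃ φ : Fin d → ℝ, (∀ i, W.mulVec φ i ≠ 0) ∧
      ∀ i j, i ≠ j → |W.mulVec φ i| ≠ |W.mulVec φ j| := by
  classical
  let P : (Fin d → ℝ) → Polynomial ℝ := fun v => ∑ k : Fin d, Polynomial.monomial (k : ℕ) (v k)
  have hP : ∀ v, v ≠ 0 → P v ≠ 0 := by
    intro v hv h
    apply hv
    ext k
    have := congrArg (fun p => p.coeff (k : ℕ)) h
    simpa [P, Polynomial.finsetSum_coeff, Polynomial.coeff_monomial, Fin.val_inj] using this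
  have hev : ∀ v x, (P v).eval x = v ⬝ᵥ (fun k : Fin d => x ^ (k : ℕ)) := by
    intro v x
    simp [P, Polynomial.eval_finset_sum, dotProduct]
  let Q : Polynomial ℝ := (∏ i, P (W i)) *
    ∏ i, ∏ j, if i = j then 1 else P (W i - W j) * P (W i + W j)
  have hQ : Q ≠ 0 := by
    refine mul_ne_zero (Finset.prod_ne_zero_iff.2 fun i _ => hP _ (hrow0 i)) ?_
    refine Finset.prod_ne_zero_iff.2 fun i _ => Finset.prod_ne_zero_iff.2 fun j _ => ?_
    split_ifs with h
    · exact one_ne_zero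
    · exact mul_ne_zero (hP _ (sub_ne_zero.2 (hrows i j h)))
        (hP _ (fun h' => hrows' i j h (eq_neg_of_add_eq_zero_left h')))
  obtain ⟨x, hx⟩ : ∃ x, Q.eval x ≠ 0 := by
    by_contra! h
    exact hQ (Polynomial.funext (by simpa using h))
  refine ⟨fun k => x ^ (k : ℕ), fun i h => hx ?_, fun i j hij h => hx ?_⟩
  · have : (P (W i)).eval x = 0 := by rw [hev]; exact h
    simp only [Q, Polynomial.eval_mul, Polynomial.eval_prod]
    rw [Finset.prod_eq_zero (Finset.mem_univ i) this, zero_mul]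
  · have : (P (W i - W j) * P (W i + W j)).eval x = 0 := by
      rw [Polynomial.eval_mul, hev, hev, sub_dotProduct, add_dotProduct]
      have h2 := sq_eq_sq_iff_abs_eq_abs _ _ |>.2 h
      simp only [mulVec] at h2
      linear_combination h2
    simp only [Q, Polynomial.eval_mul, Polynomial.eval_prod]
    rw [mul_eq_zero]; right
    refine Finset.prod_eq_zero (Finset.mem_univ i) (Finset.prod_eq_zero (Finset.mem_univ j) ?_)
    rw [if_neg hij]; exact this

open Filter Topology in
/-- For a two-layer neural network `f(φ) = νᵀσ(Wφ) + ν₀` with sigmoid activation, full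
column rank first-layer weights `W` (non-zero, pairwise non-opposite distinct rows) and
non-zero output weights `ν`, no non-zero vector `b` makes `bᵀ∇f(φ)` constant in `φ`:
for every non-zero `b` and every `a ∈ ℝ` there is `φ` with
`Σ_i ν_i · σ̇((Wφ)_i) · (Wb)_i ≠ a`, where `σ̇(x) = 1/(1 + e^{-x} + e^x)`. -/
theorem stmt_12 {d w : ℕ} (hd : 1 ≤ d) (hw : 1 ≤ w)
    (W : Matrix (Fin w) (Fin d) ℝ) (hrank : W.rank = d)
    (hrow0 : ∀ i, W i ≠ 0)
    (hrows : ∀ i j, i ≠ j → W i ≠ W j)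
    (hrows' : ∀ i j, i ≠ j → W i ≠ -W j)
    (ν : Fin w → ℝ) (hν : ∀ i, ν i ≠ 0)
    (b : Fin d → ℝ) (hb : b ≠ 0) (a : ℝ) :
    ∃ φ : Fin d → ℝ,
      ∑ i : Fin w, ν i *
          (1 / (1 + Real.exp (-(W.mulVec φ i)) + Real.exp (W.mulVec φ i))) *
          (W.mulVec b i) ≠ a := by
  classical
  by_contra! H
  obtain ⟨φ, h0, hne⟩ := aux_generic W hrow0 hrows hrows'
  have hWb : W.mulVec b ≠ 0 := by
    intro h
    have hk := LinearMap.finrank_range_add_finrank_ker W.mulVecLin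
    have hr : Module.finrank ℝ (LinearMap.range W.mulVecLin) = d := hrank
    rw [hr, Module.finrank_fin_fun] at hk
    have hk0 : LinearMap.ker W.mulVecLin = ⊥ := Submodule.finrank_eq_zero.1 (by omega)
    exact hb (LinearMap.ker_eq_bot'.1 hk0 b h)
  obtain ⟨i1, hi1⟩ := Function.ne_iff.1 hWb
  obtain ⟨i0, hi0, hmin⟩ := Finset.exists_min_image
    (Finset.univ.filter fun i => W.mulVec b i ≠ 0) (fun i => |W.mulVec φ i|)
    ⟨i1, by simpa using hi1⟩
  simp only [Finset.mem_filter, Finset.mem_univ, true_and] at hi0 hmin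
  have Ht : ∀ t : ℝ, ∑ i : Fin w, ν i *
      (1 / (1 + Real.exp (-(t * W.mulVec φ i)) + Real.exp (t * W.mulVec φ i))) *
          (W.mulVec b i) = a := by
    intro t
    have := H (t • φ)
    simpa only [mulVec_smul, Pi.smul_apply, smul_eq_mul] using this
  have L : ∀ lam : ℝ, ∀ t : ℝ, ∑ i : Fin w, ν i * (W.mulVec b i) * (Real.exp (lam * t) *
      (1 / (1 + Real.exp (-(t * W.mulVec φ i)) + Real.exp (t * W.mulVec φ i))))
        = Real.exp (lam * t) * a := by
    intro lam t
    rw [← Ht t, Finset.mul_sum]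
    exact Finset.sum_congr rfl fun i _ => by ring
  have ha : a = 0 := by
    have h1 : Tendsto (fun t : ℝ => Real.exp (0 * t) * a) atTop
        (𝓝 (∑ i : Fin w, ν i * (W.mulVec b i) * 0)) := by
      simp_rw [← L 0]
      exact tendsto_finsetSum _ fun i _ => (aux_tend0 0 _ (abs_pos.2 (h0 i))).const_mul _
    simp only [zero_mul, Real.exp_zero, one_mul, mul_zero, Finset.sum_const_zero] at h1
    exact tendsto_nhds_unique tendsto_const_nhds h1
  have h1 : Tendsto (fun t : ℝ => Real.exp (|W.mulVec φ i0| * t) * a) atTop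
      (𝓝 (∑ i : Fin w, if i = i0 then ν i * (W.mulVec b i) else 0)) := by
    simp_rw [← L]
    refine tendsto_finsetSum _ fun i _ => ?_
    split_ifs with h
    · subst h
      simpa using (aux_tend1 _ (h0 i)).const_mul (ν i * (W.mulVec b i))
    · by_cases hc : W.mulVec b i = 0
      · simp [hc]
      · simpa using (aux_tend0 _ _ (lt_of_le_of_ne (hmin i hc) (hne i0 i (Ne.symm h)))).const_mul
          (ν i * (W.mulVec b i))
  simp only [ha, mul_zero, Finset.sum_ite_eq', Finset.mem_univ, if_true] at h1
  exact mul_ne_zero (hν i0) hi0 (tendsto_nhds_unique h1 tendsto_const_nhds)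
end

section
/- Let n ≥ 1 and let Ch : {1,…,n} → subsets of {1,…,n} assign to each node its set of children in a DAG. Define Σ ∈ {0,1}^{n×n} by Σ_{i,j} = 1 if and only if {j} ∪ Ch(j) ⊆ Ch(i). Let Λ ∈ ℝ^{n×n} be strictly upper triangular (Λ_{i,j} = 0 whenever j ≤ i) and supported on Σ (Λ_{i,j} ≠ 0 implies Σ_{i,j} = 1). Then I_n + Λ is invertible, and for every pair i ≠ j, if the (i,j) entry of (I_n + Λ)^{-1} is non-zero then Σ_{i,j} = 1; that is, the support of (I_n + Λ)^{-1} is contained in I_n + Σ. -/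
open Matrix

/-- Let `Ch` assign to each node of a DAG on `{1,…,n}` its set of children, and let
`Λ` be a strictly upper triangular real matrix supported on the surrounding pattern
`Σ_{i,j} = 1 ↔ {j} ∪ Ch(j) ⊆ Ch(i)`. Then `I + Λ` is invertible and the support of
`(I + Λ)⁻¹` is contained in `I + Σ`: every non-zero off-diagonal entry `(i,j)` of
`(I + Λ)⁻¹` satisfies `{j} ∪ Ch(j) ⊆ Ch(i)`. -/
theorem stmt_14 {n : ℕ} (hn : 1 ≤ n) (Ch : Fin n → Finset (Fin n))
    (Λ : Matrix (Fin n) (Fin n) ℝ)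
    (hΛtri : ∀ i j : Fin n, j ≤ i → Λ i j = 0)
    (hΛsupp : ∀ i j : Fin n, Λ i j ≠ 0 → insert j (Ch j) ⊆ Ch i) :
    IsUnit (1 + Λ).det ∧
      ∀ i j : Fin n, i ≠ j → (1 + Λ)⁻¹ i j ≠ 0 → insert j (Ch j) ⊆ Ch i := by
  have hdet : (1 + Λ).det = 1 := by
    rw [Matrix.det_of_upperTriangular]
    · apply Finset.prod_eq_one
      intro i _
      simp [hΛtri i i le_rfl]
    · intro i j hij
      have hij' : j < i := hij
      simp [Matrix.one_apply_ne hij'.ne', hΛtri i j hij'.le]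
  have hu : IsUnit (1 + Λ).det := by rw [hdet]; exact isUnit_one
  refine ⟨hu, ?_⟩
  have hmul := Matrix.mul_nonsing_inv (1 + Λ) hu
  generalize (1 + Λ)⁻¹ = B at hmul
  rw [add_mul, one_mul] at hmul
  suffices h : ∀ m : ℕ, ∀ i j : Fin n, n - i.val = m → i ≠ j → B i j ≠ 0 →
      insert j (Ch j) ⊆ Ch i from fun i j => h _ i j rfl
  intro m
  induction m using Nat.strong_induction_on with
  | _ m ih =>
    intro i j him hij hB
    have h1 := congrFun (congrFun hmul i) j
    rw [Matrix.add_apply, Matrix.one_apply_ne hij, Matrix.mul_apply] at h1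
    have h2 : ∑ k, Λ i k * B k j ≠ 0 := by
      intro h0
      rw [h0, add_zero] at h1
      exact hB h1
    obtain ⟨k, -, hk⟩ := Finset.exists_ne_zero_of_sum_ne_zero h2
    have hL := left_ne_zero_of_mul hk
    have hR := right_ne_zero_of_mul hk
    have hik : i < k := by
      by_contra hc
      exact hL (hΛtri i k (not_lt.mp hc))
    have hs := hΛsupp i k hL
    by_cases hkj : k = j
    · exact hkj ▸ hs
    · have hlt : i.val < k.val := hik
      have := ih (n - k.val) (by have := k.isLt; omega) k j rfl hkj hR
      exact this.trans ((Finset.subset_insert _ _).trans hs)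
end

section
/- Let n ≥ 1 and let D ∈ ℝ^{n×n} be upper triangular (D_{i,j} = 0 whenever j < i) with all diagonal entries non-zero (D_{i,i} ≠ 0 for all i). Let π and τ be permutations of {1,…,n}, and define the matrix K ∈ ℝ^{n×n} by K_{π(i),τ(j)} = D_{i,j} for all i, j (i.e., K is obtained from D by relabeling rows via π and columns via τ). If K is upper triangular (K_{i,j} = 0 whenever j < i), then π = τ; moreover, for every pair i, j with D_{i,j} ≠ 0 one then has π(i) ≤ π(j). -/
open Matrix

/-- Let `D` be upper triangular with non-zero diagonal, and let `K` be obtained from `D`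
by relabeling rows via a permutation `π` and columns via a permutation `τ`
(`K (π i) (τ j) = D i j`). If `K` is upper triangular, then `π = τ`, and moreover
`π i ≤ π j` whenever `D i j ≠ 0`. -/
theorem stmt_15 {n : ℕ} (hn : 1 ≤ n) (D K : Matrix (Fin n) (Fin n) ℝ)
    (hDtri : ∀ i j : Fin n, j < i → D i j = 0)
    (hDdiag : ∀ i : Fin n, D i i ≠ 0)
    (π τ : Equiv.Perm (Fin n))
    (hK : ∀ i j : Fin n, K (π i) (τ j) = D i j)
    (hKtri : ∀ i j : Fin n, j < i → K i j = 0) :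
    π = τ ∧ ∀ i j : Fin n, D i j ≠ 0 → π i ≤ π j := by
  have key : ∀ i j : Fin n, D i j ≠ 0 → π i ≤ τ j := by
    intro i j h
    by_contra hlt
    exact h (by rw [← hK]; exact hKtri _ _ (not_le.mp hlt))
  have hle : ∀ i ∈ Finset.univ, (π i).val ≤ (τ i).val := fun i _ => key i i (hDdiag i)
  have hsum : ∑ i, (π i).val = ∑ i, (τ i).val := by
    rw [Equiv.sum_comp π (fun i : Fin n => i.val), Equiv.sum_comp τ (fun i : Fin n => i.val)]
  have heq : π = τ := by
    ext i
    exact (Finset.sum_eq_sum_iff_of_le hle).mp hsum i (Finset.mem_univ i)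
  refine ⟨heq, fun i j h => ?_⟩
  have := key i j h
  rwa [← heq] at this
end
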